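/- arXiv:1202.3940 — 3 statements merged into one kernel-verified Lean document; each statement's English description precedes it below -/
import Mathlib

section
/- For every vertex model h ∈ R*, every g ∈ O_n, every k ∈ ℕ, and every k-fragment F, one has g · p_h(F) = p_{gh}(F), where g acts diagonally on V^{⊗k} and gh denotes the action of g on h ∈ R*. -/
/-!
Formalization framework for "Partition functions of vertex models /
edge connection matrices" (Regts–Draisma style).

Graphs and fragments are finite multigraphs (allowing multiple edges, loops
and circles); a `k`-fragment additionally has `k` labelled open ends.  We
encode a `k`-fragment by a number `nv` of internal vertices, a number `ne`
of edges, and for each edge the multiset of its endpoints, each endpoint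
being either an internal vertex (`Sum.inl`) or an open-end label
(`Sum.inr`).  Every edge has `2` endpoints (counted with multiplicity; a
loop at `v` lists `v` twice) or `0` endpoints (a circle), and every label
occurs exactly once in total (the open ends have degree one).
-/

open MvPolynomial

namespace VertexModels

noncomputable section

/-- A `k`-fragment. For `k = 0` this is a graph. -/
structure Fragment (k : ℕ) : Type where
  nv : ℕ
  ne : ℕ
  inc : Fin ne → Multiset (Fin nv ⊕ Fin k)
  card_inc : ∀ e, Multiset.card (inc e) = 2 ∨ Multiset.card (inc e) = 0
  openEnd : ∀ j : Fin k, (∑ e, (inc e).count (Sum.inr j)) = 1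

/-- A graph: a `0`-fragment. -/
abbrev Graph := Fragment 0

/-- The basic `k`-fragment `F_k`: one internal vertex joined to each of the
`k` open ends by a half edge. -/
def basicFragment (k : ℕ) : Fragment k where
  nv := 1
  ne := k
  inc := fun e => {Sum.inl 0, Sum.inr e}
  card_inc := fun e => Or.inl (by simp)
  openEnd := fun j => by
    have h : ∀ e : Fin k,
        Multiset.count (Sum.inr j) ({Sum.inl 0, Sum.inr e} : Multiset (Fin 1 ⊕ Fin k))
          = if j = e then 1 else 0 := by
      intro e
      by_cases he : j = e <;>
        simp [Multiset.count_cons, Multiset.count_singleton, he]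
    simp only [h]
    simp

variable {𝔽 : Type} [Field 𝔽] {n : ℕ}

/-- A vertex model: a linear functional on `R = 𝔽[x_1, …, x_n]`. -/
abbrev VertexModel (𝔽 : Type) [Field 𝔽] (n : ℕ) : Type :=
  MvPolynomial (Fin n) 𝔽 →ₗ[𝔽] 𝔽

/-- The monomial `∏_{e ∈ δ(v)} x_{ψ(e)}` seen by the internal vertex `v` of a
fragment under the edge colouring `ψ`. -/
def monomialAt {k : ℕ} (F : Fragment k) (ψ : Fin F.ne → Fin n) (v : Fin F.nv) :
    MvPolynomial (Fin n) 𝔽 :=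
  ∏ e, (X (ψ e) : MvPolynomial (Fin n) 𝔽) ^ ((F.inc e).count (Sum.inl v))

/-- The partition function `f_h` of the vertex model `h`. -/
def partitionFun (h : VertexModel 𝔽 n) (G : Graph) : 𝔽 :=
  ∑ ψ : Fin G.ne → Fin n, ∏ v, h (monomialAt G ψ v)

/-- `h_φ(F)`, for a `k`-fragment `F` and a colouring `φ` of the open ends. -/
def hphi (h : VertexModel 𝔽 n) {k : ℕ} (F : Fragment k) (φ : Fin k → Fin n) : 𝔽 :=
  ∑ ψ ∈ Finset.univ.filter
      (fun ψ : Fin F.ne → Fin n => ∀ (e : Fin F.ne) (j : Fin k),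
        Sum.inr j ∈ F.inc e → ψ e = φ j),
    ∏ v, h (monomialAt F ψ v)

/-- `V^{⊗ k}` in coordinates: functions on multi-indices, with basis
`e_φ`. -/
abbrev Tensor (𝔽 : Type) [Field 𝔽] (n k : ℕ) : Type := (Fin k → Fin n) → 𝔽

/-- The tensor `p_h(F) = ∑_φ h_φ(F) e_φ ∈ V^{⊗ k}`. -/
def ph (h : VertexModel 𝔽 n) {k : ℕ} (F : Fragment k) : Tensor 𝔽 n k :=
  fun φ => hphi h F φ

/-- The standard bilinear form on `V^{⊗ k}`. -/
def tpair {k : ℕ} (t s : Tensor 𝔽 n k) : 𝔽 := ∑ φ, t φ * s φ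

/-- Tensor product `V^{⊗ k} × V^{⊗ l} → V^{⊗ (k+l)}`. -/
def tmul {k l : ℕ} (t : Tensor 𝔽 n k) (s : Tensor 𝔽 n l) : Tensor 𝔽 n (k + l) :=
  fun φ => t (fun i => φ (Fin.castAdd l i)) * s (fun i => φ (Fin.natAdd k i))

/-- The contraction `C^k_{i,j} : V^{⊗ k} → V^{⊗ (k-2)}` (here `k = m + 2`),
contracting the `i`-th and `j`-th tensor factors (`i < j`). -/
def tcontract {m : ℕ} (i j : Fin (m + 2)) (t : Tensor 𝔽 n (m + 2)) : Tensor 𝔽 n m :=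
  fun φ => ∑ c : Fin n,
    t (Fin.insertNth i c (Fin.insertNth (⟨j.1 - 1, by have := j.isLt; omega⟩ : Fin (m + 1)) c φ))

/-- The orthogonal group `O_n`, as the set of matrices `g` with `gᵀ g = 1`. -/
def orthSet (𝔽 : Type) [Field 𝔽] (n : ℕ) : Set (Matrix (Fin n) (Fin n) 𝔽) :=
  {g | g.transpose * g = 1}

/-- Substitution `X i ↦ ∑ j, g i j • X j`, i.e. composition of a polynomial
with the linear map `g`, as a linear endomorphism of `R`. -/
noncomputable def polSub (g : Matrix (Fin n) (Fin n) 𝔽) :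
    MvPolynomial (Fin n) 𝔽 →ₗ[𝔽] MvPolynomial (Fin n) 𝔽 :=
  (MvPolynomial.aeval (fun i => ∑ j, MvPolynomial.C (g i j) * X j)).toLinearMap

/-- The action of `g ∈ O_n` on vertex models: `(g h)(p) = h (p ∘ g) = h(g⁻¹ • p)`. -/
noncomputable def dualAct (g : Matrix (Fin n) (Fin n) 𝔽) (h : VertexModel 𝔽 n) :
    VertexModel 𝔽 n :=
  h.comp (polSub g)

/-- The stabilizer `Stab(h) = {g ∈ O_n ∣ g h = h}`. -/
noncomputable def Stab (h : VertexModel 𝔽 n) : Set (Matrix (Fin n) (Fin n) 𝔽) :=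
  {g | g ∈ orthSet 𝔽 n ∧ dualAct g h = h}

/-- The diagonal action of a matrix `g` on `V^{⊗ k}`. -/
def tact (g : Matrix (Fin n) (Fin n) 𝔽) (k : ℕ) :
    Tensor 𝔽 n k →ₗ[𝔽] Tensor 𝔽 n k :=
  Matrix.mulVecLin (Matrix.of fun φ ψ : Fin k → Fin n => ∏ i, g (φ i) (ψ i))

/-- The subspace `(V^{⊗ k})^S` of tensors fixed by every element of a set `S`
of matrices. -/
def invSub (S : Set (Matrix (Fin n) (Fin n) 𝔽)) (k : ℕ) :
    Submodule 𝔽 (Tensor 𝔽 n k) where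
  carrier := {t | ∀ g ∈ S, tact g k t = t}
  add_mem' := fun {a b} ha hb => by
    intro g hg
    rw [map_add, ha g hg, hb g hg]
  zero_mem' := by
    intro g hg
    rw [map_zero]
  smul_mem' := fun c a ha => by
    intro g hg
    rw [map_smul, ha g hg]

/-! ### Gluing two `k`-fragments into a graph -/

/-- `touches F H j a`: the edge `a` of the disjoint union of `F` and `H` is
incident with the open end labelled `j` (of its own fragment). -/
def touches {k : ℕ} (F H : Fragment k) (j : Fin k) : Fin F.ne ⊕ Fin H.ne → Prop
  | .inl e => Sum.inr j ∈ F.inc e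
  | .inr e => Sum.inr j ∈ H.inc e

/-- Edges of `F` and `H` which get merged into a single edge of `F * H` are
identified by the equivalence generated by sharing an open-end label. -/
def glueSetoid {k : ℕ} (F H : Fragment k) : Setoid (Fin F.ne ⊕ Fin H.ne) :=
  Relation.EqvGen.setoid (fun a b => ∃ j, touches F H j a ∧ touches F H j b)

/-- Number of edges of the glued graph `F * H`. -/
noncomputable def glueNE {k : ℕ} (F H : Fragment k) : ℕ :=
  Nat.card (Quotient (glueSetoid F H))

noncomputable def glueEquiv {k : ℕ} (F H : Fragment k) :
    Fin (glueNE F H) ≃ Quotient (glueSetoid F H) :=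
  (Finite.equivFin _).symm

/-- The internal (non-open-end) endpoints of an edge of the disjoint union,
re-indexed in `Fin (F.nv + H.nv)`. -/
def intEnds {k : ℕ} (F H : Fragment k) :
    Fin F.ne ⊕ Fin H.ne → Multiset (Fin (F.nv + H.nv) ⊕ Fin 0)
  | .inl e => (F.inc e).filterMap fun x =>
      match x with
      | .inl v => some (Sum.inl (Fin.castAdd H.nv v))
      | .inr _ => none
  | .inr e => (H.inc e).filterMap fun x =>
      match x with
      | .inl v => some (Sum.inl (Fin.natAdd F.nv v))
      | .inr _ => none

/-- Endpoints of an edge of the glued graph: the internal endpoints of all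
edges merged into it. -/
noncomputable def glueInc {k : ℕ} (F H : Fragment k) (c : Fin (glueNE F H)) :
    Multiset (Fin (F.nv + H.nv) ⊕ Fin 0) := by
  classical
  exact ∑ a ∈ Finset.univ.filter
    (fun a => Quotient.mk (glueSetoid F H) a = glueEquiv F H c), intEnds F H a

/-- The glued graph `F * H` of two `k`-fragments: connect the half edges
with equally labelled open ends into single edges (chains of half edges
closing up produce circles).  (The impossible degenerate branch is never
taken.) -/
noncomputable def glue {k : ℕ} (F H : Fragment k) : Graph := by
  classical
  exact if hc : ∀ c, Multiset.card (glueInc F H c) = 2 ∨ Multiset.card (glueInc F H c) = 0 then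
    { nv := F.nv + H.nv
      ne := glueNE F H
      inc := glueInc F H
      card_inc := hc
      openEnd := fun j => j.elim0 }
  else basicFragment 0

/-- The rank of the edge connection matrix `M_{f_h,k}` : the dimension of the
span of its rows. -/
noncomputable def connectionRank (h : VertexModel 𝔽 n) (k : ℕ) : ℕ :=
  Module.finrank 𝔽 (Submodule.span 𝔽
    (Set.range fun F : Fragment k => fun H : Fragment k => partitionFun h (glue F H)))

/-! ### The algebra `𝒜` of formal linear combinations of fragments -/

/-- `p_h` on formal linear combinations `𝔽ℱ_k` of `k`-fragments. -/
noncomputable def phL (h : VertexModel 𝔽 n) (k : ℕ) :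
    (Fragment k →₀ 𝔽) →ₗ[𝔽] Tensor 𝔽 n k :=
  Finsupp.linearCombination 𝔽 (fun F : Fragment k => ph h F)

/-- `γ ↦ (F ↦ f_h(γ * F))`: the bilinear extension of gluing followed by the
partition function.  Its kernel is `I_k`. -/
noncomputable def glueRow (h : VertexModel 𝔽 n) (k : ℕ) :
    (Fragment k →₀ 𝔽) →ₗ[𝔽] (Fragment k → 𝔽) :=
  Finsupp.linearCombination 𝔽
    (fun F : Fragment k => fun H : Fragment k => partitionFun h (glue F H))

/-- A vertex model is nondegenerate if `ker p_h = I`. -/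
def Nondeg (h : VertexModel 𝔽 n) : Prop :=
  ∀ (k : ℕ) (γ : Fragment k →₀ 𝔽), phL h k γ = 0 ↔ glueRow h k γ = 0

/-! ### The product of fragments and the contraction of fragments -/

/-- Endpoint multisets of the disjoint union `F H` of fragments (`H`'s open
ends relabelled by `i ↦ k + i`). -/
def mulInc {k l : ℕ} (F : Fragment k) (H : Fragment l) :
    Fin (F.ne + H.ne) → Multiset (Fin (F.nv + H.nv) ⊕ Fin (k + l)) :=
  Fin.addCases
    (fun e => (F.inc e).map (Sum.map (Fin.castAdd H.nv) (Fin.castAdd l)))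
    (fun e => (H.inc e).map (Sum.map (Fin.natAdd F.nv) (Fin.natAdd k)))

/-- The product `F H` in the fragment algebra `𝒜`: disjoint union, with the
open ends of `H` relabelled `i ↦ k + i`.  (The impossible degenerate branch
is never taken.) -/
noncomputable def fragMul {k l : ℕ} (F : Fragment k) (H : Fragment l) :
    Fragment (k + l) := by
  classical
  exact if hc : (∀ e, Multiset.card (mulInc F H e) = 2 ∨ Multiset.card (mulInc F H e) = 0)
      ∧ (∀ j : Fin (k + l), (∑ e, (mulInc F H e).count (Sum.inr j)) = 1) then
    { nv := F.nv + H.nv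
      ne := F.ne + H.ne
      inc := mulInc F H
      card_inc := hc.1
      openEnd := hc.2 }
  else basicFragment (k + l)

/-- Relabelling map for labels after removing labels `i` and `j` (`i < j`),
preserving the order of the remaining labels. -/
def downLabel {m : ℕ} (i j l : Fin (m + 2)) (hij : i < j) (h : ¬(l = i ∨ l = j)) : Fin m :=
  ⟨l.1 - (if i.1 < l.1 then 1 else 0) - (if j.1 < l.1 then 1 else 0), by
    push_neg at h
    have h1 : l.1 ≠ i.1 := fun hh => h.1 (Fin.ext hh)
    have h2 : l.1 ≠ j.1 := fun hh => h.2 (Fin.ext hh)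
    have h3 : i.1 < j.1 := hij
    have h4 := l.isLt
    have h6 := j.isLt
    split_ifs <;> omega⟩

/-- Removing the open ends `i` and `j` from an endpoint multiset and
relabelling the remaining open ends. -/
def removeEnd {m nv : ℕ} (i j : Fin (m + 2)) (hij : i < j) :
    Fin nv ⊕ Fin (m + 2) → Option (Fin nv ⊕ Fin m)
  | .inl v => some (.inl v)
  | .inr l => if h : l = i ∨ l = j then none else some (.inr (downLabel i j l hij h))

/-- Edges merged by the contraction `Γ^k_{i,j}`: those incident with the open
end `i` or the open end `j`. -/
def contractSetoid {m : ℕ} (F : Fragment (m + 2)) (i j : Fin (m + 2)) :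
    Setoid (Fin F.ne) :=
  Relation.EqvGen.setoid (fun e e' =>
    (Sum.inr i ∈ F.inc e ∨ Sum.inr j ∈ F.inc e) ∧
    (Sum.inr i ∈ F.inc e' ∨ Sum.inr j ∈ F.inc e'))

noncomputable def contractNE {m : ℕ} (F : Fragment (m + 2)) (i j : Fin (m + 2)) : ℕ :=
  Nat.card (Quotient (contractSetoid F i j))

noncomputable def contractEquiv {m : ℕ} (F : Fragment (m + 2)) (i j : Fin (m + 2)) :
    Fin (contractNE F i j) ≃ Quotient (contractSetoid F i j) :=
  (Finite.equivFin _).symm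

noncomputable def contractInc {m : ℕ} (F : Fragment (m + 2)) (i j : Fin (m + 2))
    (hij : i < j) (c : Fin (contractNE F i j)) : Multiset (Fin F.nv ⊕ Fin m) := by
  classical
  exact ∑ e ∈ Finset.univ.filter
    (fun e => Quotient.mk (contractSetoid F i j) e = contractEquiv F i j c),
    (F.inc e).filterMap (removeEnd i j hij)

/-- The contraction `Γ^k_{i,j}(F)` of a `(m+2)`-fragment: join the half edges
at the open ends labelled `i` and `j` into a single edge (possibly a circle)
and relabel the remaining open ends preserving their order.  (The impossible
degenerate branch is never taken.) -/
noncomputable def fragContract {m : ℕ} (i j : Fin (m + 2)) (hij : i < j)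
    (F : Fragment (m + 2)) : Fragment m := by
  classical
  exact if hc : (∀ c, Multiset.card (contractInc F i j hij c) = 2 ∨
        Multiset.card (contractInc F i j hij c) = 0)
      ∧ (∀ jj : Fin m, (∑ c, (contractInc F i j hij c).count (Sum.inr jj)) = 1) then
    { nv := F.nv
      ne := contractNE F i j
      inc := contractInc F i j hij
      card_inc := hc.1
      openEnd := hc.2 }
  else basicFragment m

/-! ### Zariski closedness, spin models, reductivity -/

/-- A subset of a coordinate space `ι → 𝔽` is Zariski closed if it is the
common zero locus of a set of polynomials. -/
def IsZarClosed {ι : Type} (S : Set (ι → 𝔽)) : Prop :=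
  ∃ P : Set (MvPolynomial ι 𝔽), S = {x | ∀ p ∈ P, MvPolynomial.eval x p = 0}

/-- The vertex model `h(p) = ∑ i, a i • p (u i)` attached to points
`u_1, …, u_m` and coefficients `a_1, …, a_m`. -/
noncomputable def spinModel {m : ℕ} (u : Fin m → (Fin n → 𝔽)) (a : Fin m → 𝔽) :
    VertexModel 𝔽 n :=
  ∑ i, a i • (MvPolynomial.aeval (u i) : MvPolynomial (Fin n) 𝔽 →ₐ[𝔽] 𝔽).toLinearMap

/-- Multi-degrees of total degree at most `e`: coordinates for the space
`(R_{≤ e})^*`. -/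
def LowDeg (n e : ℕ) : Type := {d : Fin n →₀ ℕ // (d.sum fun _ c => c) ≤ e}

/-- The `O_n`-orbit of `h_e` (the restriction of `h` to polynomials of degree
at most `e`), in coordinates. -/
noncomputable def restOrbit (h : VertexModel 𝔽 n) (e : ℕ) : Set (LowDeg n e → 𝔽) :=
  {y | ∃ g ∈ orthSet 𝔽 n, ∀ d : LowDeg n e,
    y d = dualAct g h (MvPolynomial.monomial d.1 (1 : 𝔽))}

/-- The `O_n`-orbit of an `m`-tuple of vectors, in coordinates. -/
def vecOrbit {m : ℕ} (u : Fin m → (Fin n → 𝔽)) : Set (Fin m × Fin n → 𝔽) :=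
  {y | ∃ g ∈ orthSet 𝔽 n, ∀ p : Fin m × Fin n, y p = g.mulVec (u p.1) p.2}

/-- The `O_n`-orbit of an element `w` of `⊕_{k ≤ e} V^{⊗ k}`, in
coordinates. -/
def tensorTupleOrbit (e : ℕ) (w : ∀ k : ℕ, Tensor 𝔽 n k) :
    Set ((Σ p : Fin (e + 1), (Fin p.1 → Fin n)) → 𝔽) :=
  {y | ∃ g ∈ orthSet 𝔽 n, ∀ q : Σ p : Fin (e + 1), (Fin p.1 → Fin n),
    y q = tact g q.1 (w q.1) q.2}

/-- Linear reductivity of a set `H` of `n × n` matrices: in every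
polynomial representation of `H`, every `H`-invariant subspace admits an
`H`-invariant complement. -/
def IsLinRed (H : Set (Matrix (Fin n) (Fin n) 𝔽)) : Prop :=
  ∀ (m : ℕ) (ρ : Matrix (Fin n) (Fin n) 𝔽 → Matrix (Fin m) (Fin m) 𝔽),
    (∀ a b : Fin m, ∃ p : MvPolynomial (Fin n × Fin n) 𝔽,
      ∀ g, ρ g a b = MvPolynomial.eval (fun q => g q.1 q.2) p) →
    (∀ g ∈ H, ∀ g' ∈ H, ρ (g * g') = ρ g * ρ g') → ρ 1 = 1 →
    ∀ W : Submodule 𝔽 (Fin m → 𝔽),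
      (∀ g ∈ H, ∀ w ∈ W, (ρ g).mulVec w ∈ W) →
      ∃ W' : Submodule 𝔽 (Fin m → 𝔽), IsCompl W W' ∧
        (∀ g ∈ H, ∀ w ∈ W', (ρ g).mulVec w ∈ W')

/-- The pointwise stabilizer in `O_n` of a graded family of subspaces of the
tensor algebra. -/
def setStab (A : ∀ k : ℕ, Submodule 𝔽 (Tensor 𝔽 n k)) :
    Set (Matrix (Fin n) (Fin n) 𝔽) :=
  {g | g ∈ orthSet 𝔽 n ∧ ∀ (k : ℕ), ∀ a ∈ A k, tact g k a = a}

/-- The sum of the nontrivial `H`-isotypic components of `V^{⊗ k}`: the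
largest `H`-stable subspace meeting the invariants trivially. -/
def nontrivialPart (H : Set (Matrix (Fin n) (Fin n) 𝔽)) (k : ℕ) :
    Submodule 𝔽 (Tensor 𝔽 n k) :=
  sSup {W | (∀ g ∈ H, ∀ w ∈ W, tact g k w ∈ W) ∧ W ⊓ invSub H k = ⊥}

end

end VertexModels

open VertexModels

namespace VertexModels

open PiTensorProduct
open scoped TensorProduct

variable {𝔽 : Type} [Field 𝔽] {n k : ℕ}

/-- The functional `⨂ᵥ pᵥ ↦ ∏ᵥ h(pᵥ)`. -/
noncomputable def tensorFunctional (h : VertexModel 𝔽 n) (m : ℕ) :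
    (⨂[𝔽] _ : Fin m, MvPolynomial (Fin n) 𝔽) →ₗ[𝔽] 𝔽 :=
  lift ((MultilinearMap.mkPiAlgebra 𝔽 (Fin m) 𝔽).compLinearMap fun _ => h)

theorem tensorFunctional_tprod (h : VertexModel 𝔽 n) {m : ℕ}
    (p : Fin m → MvPolynomial (Fin n) 𝔽) :
    tensorFunctional h m (tprod 𝔽 p) = ∏ v, h (p v) := by
  simp [tensorFunctional]

theorem prod_singleAlgHom {m : ℕ} (p : Fin m → MvPolynomial (Fin n) 𝔽) :
    ∏ v, singleAlgHom (R := 𝔽) (A := fun _ : Fin m => MvPolynomial (Fin n) 𝔽) v (p v) =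
      tprod 𝔽 p := by
  simp only [singleAlgHom_apply, MonoidHom.mulSingle_apply]
  rw [← tprod_prod, Finset.univ_prod_mulSingle]

/-- The partition function of `F` in which colour `c` contributes the polynomial `P c` at each
internal end and the weight `W j c` at the open end `j`. -/
noncomputable def weightedSum (h : VertexModel 𝔽 n) (F : Fragment k)
    (P : Fin n → MvPolynomial (Fin n) 𝔽) (W : Fin k → Fin n → 𝔽) : 𝔽 :=
  ∑ ψ : Fin F.ne → Fin n,
    (∏ e, ∏ j, W j (ψ e) ^ (F.inc e).count (Sum.inr j)) *
      ∏ v, h (∏ e, P (ψ e) ^ (F.inc e).count (Sum.inl v))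

/-- The contribution of an end of an edge of colour `c`, as an element of `R^{⊗ m}`. -/
noncomputable def endWeight {m : ℕ} (P : Fin n → MvPolynomial (Fin n) 𝔽)
    (W : Fin k → Fin n → 𝔽) : Fin m ⊕ Fin k → Fin n →
      ⨂[𝔽] _ : Fin m, MvPolynomial (Fin n) 𝔽
  | .inl v, c => singleAlgHom (R := 𝔽) (A := fun _ : Fin m => MvPolynomial (Fin n) 𝔽) v (P c)
  | .inr j, c => algebraMap 𝔽 _ (W j c)

theorem weightedSum_eq_tensorFunctional (h : VertexModel 𝔽 n) (F : Fragment k)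
    (P : Fin n → MvPolynomial (Fin n) 𝔽) (W : Fin k → Fin n → 𝔽) :
    weightedSum h F P W =
      tensorFunctional h F.nv
        (∏ e, ∑ c, ((F.inc e).map fun x => endWeight P W x c).prod) := by
  rw [Finset.prod_univ_sum, map_sum, Fintype.piFinset_univ]
  refine Finset.sum_congr rfl fun ψ _ => ?_
  have key (e : Fin F.ne) : ((F.inc e).map fun x => endWeight P W x (ψ e)).prod =
      tprod 𝔽 (fun v => P (ψ e) ^ (F.inc e).count (Sum.inl v)) *
        algebraMap 𝔽 _ (∏ j, W j (ψ e) ^ (F.inc e).count (Sum.inr j)) := by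
    rw [Finset.prod_multiset_map_count, Finset.prod_subset (Finset.subset_univ _)]
    · rw [Fintype.prod_sum_type, ← prod_singleAlgHom]
      simp only [endWeight, map_pow, map_prod]
    · intro x _ hx
      rw [Multiset.mem_toFinset, ← Multiset.count_eq_zero] at hx
      rw [hx, pow_zero]
  simp_rw [key]
  rw [Finset.prod_mul_distrib, ← map_prod (algebraMap 𝔽 _), ← tprod_prod,
    mul_comm (PiTensorProduct.tprod 𝔽 _), ← Algebra.smul_def, map_smul,
    tensorFunctional_tprod, smul_eq_mul]
  simp only [Finset.prod_apply]

theorem sum_prod_map_of_orthogonal {A ι : Type*} [CommRing A] [Algebra 𝔽 A]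
    {g : Matrix (Fin n) (Fin n) 𝔽} (hg : g ∈ orthSet 𝔽 n) (Z : ι → Fin n → A) {s : Multiset ι}
    (hs : s.card = 2 ∨ s.card = 0) :
    ∑ c, (s.map fun x => ∑ d, g c d • Z x d).prod = ∑ c, (s.map fun x => Z x c).prod := by
  rcases hs with hs | hs
  · obtain ⟨x, y, rfl⟩ := Multiset.card_eq_two.mp hs
    have hg' (d d' : Fin n) : ∑ c, g c d * g c d' = if d = d' then 1 else 0 := by
      have := congrFun (congrFun hg d) d'
      simpa [Matrix.mul_apply, Matrix.one_apply] using this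
    simp only [Multiset.insert_eq_cons, Multiset.map_cons, Multiset.map_singleton,
      Multiset.prod_cons, Multiset.prod_singleton, Finset.sum_mul_sum, smul_mul_smul_comm]
    rw [Finset.sum_comm]
    refine Finset.sum_congr rfl fun d _ => ?_
    rw [Finset.sum_comm]
    simp_rw [← Finset.sum_smul, hg']
    simp
  · rw [Multiset.card_eq_zero.mp hs]
    simp

theorem weightedSum_orthogonal (h : VertexModel 𝔽 n) (F : Fragment k)
    {g : Matrix (Fin n) (Fin n) 𝔽} (hg : g ∈ orthSet 𝔽 n)
    (P : Fin n → MvPolynomial (Fin n) 𝔽) (W : Fin k → Fin n → 𝔽) :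
    weightedSum h F (fun c => ∑ d, g c d • P d) (fun j c => ∑ d, g c d * W j d) =
      weightedSum h F P W := by
  rw [weightedSum_eq_tensorFunctional, weightedSum_eq_tensorFunctional]
  congr 1
  refine Finset.prod_congr rfl fun e _ => ?_
  rw [← sum_prod_map_of_orthogonal hg (endWeight P W) (F.card_inc e)]
  refine Finset.sum_congr rfl fun c _ => ?_
  congr 2
  funext x
  cases x with
  | inl v => simp only [endWeight, map_sum, map_smul]
  | inr j => simp only [endWeight, map_sum, map_mul, Algebra.smul_def]

theorem hphi_eq_weightedSum (h : VertexModel 𝔽 n) (F : Fragment k) (φ : Fin k → Fin n) :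
    hphi h F φ = weightedSum h F X (fun j c => if c = φ j then 1 else 0) := by
  rw [hphi, weightedSum, Finset.sum_filter]
  refine Finset.sum_congr rfl fun ψ _ => ?_
  simp only [monomialAt]
  split_ifs with hψ
  · refine ((congrArg (· * _) ?_).trans (one_mul _)).symm
    refine Finset.prod_eq_one fun e _ => Finset.prod_eq_one fun j _ => ?_
    by_cases hj : Sum.inr j ∈ F.inc e
    · simp [hψ e j hj]
    · simp [Multiset.count_eq_zero.mpr hj]
  · push Not at hψ
    obtain ⟨e, j, hj, hne⟩ := hψ
    rw [Finset.prod_eq_zero (Finset.mem_univ e), zero_mul]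
    refine Finset.prod_eq_zero (Finset.mem_univ j) ?_
    simp [hne, hj]

theorem hphi_dualAct (h : VertexModel 𝔽 n) (g : Matrix (Fin n) (Fin n) 𝔽) (F : Fragment k)
    (φ : Fin k → Fin n) :
    hphi (dualAct g h) F φ =
      weightedSum h F (fun c => ∑ d, g c d • X d) (fun j c => if c = φ j then 1 else 0) := by
  rw [hphi_eq_weightedSum]
  simp [weightedSum, dualAct, polSub, MvPolynomial.smul_eq_C_mul]

theorem Fragment.exists_openEdge (F : Fragment k) (j : Fin k) :
    ∃ e₀, ∀ e, (F.inc e).count (Sum.inr j) = if e = e₀ then 1 else 0 := by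
  have hsum := F.openEnd j
  obtain ⟨e₀, -, he₀⟩ := Finset.exists_ne_zero_of_sum_ne_zero (hsum.trans_ne one_ne_zero)
  refine ⟨e₀, fun e => ?_⟩
  rw [← Finset.add_sum_erase _ _ (Finset.mem_univ e₀)] at hsum
  split_ifs with he
  · subst he
    omega
  · have := Finset.single_le_sum (f := fun e => (F.inc e).count (Sum.inr j))
      (fun _ _ => Nat.zero_le _) (Finset.mem_erase.mpr ⟨he, Finset.mem_univ e⟩)
    omega

theorem Fragment.prod_openEnd (F : Fragment k) :
    ∃ ε : Fin k → Fin F.ne, ∀ (W : Fin k → Fin n → 𝔽) (ψ : Fin F.ne → Fin n),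
      ∏ e, ∏ j, W j (ψ e) ^ (F.inc e).count (Sum.inr j) = ∏ j, W j (ψ (ε j)) := by
  choose ε hε using F.exists_openEdge
  refine ⟨ε, fun W ψ => ?_⟩
  rw [Finset.prod_comm]
  simp [hε, pow_ite]

theorem sum_prod_mul_weightedSum (h : VertexModel 𝔽 n) (F : Fragment k)
    (P : Fin n → MvPolynomial (Fin n) 𝔽) (W : Fin k → Fin n → 𝔽) :
    ∑ φ : Fin k → Fin n,
      (∏ j, W j (φ j)) * weightedSum h F P (fun j c => if c = φ j then 1 else 0) =
      weightedSum h F P W := by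
  obtain ⟨ε, hε⟩ := F.prod_openEnd (𝔽 := 𝔽) (n := n)
  have hδ (φ : Fin k → Fin n) := hε fun j c => if c = φ j then 1 else 0
  simp only [weightedSum, hε W, hδ, Finset.mul_sum]
  rw [Finset.sum_comm]
  refine Finset.sum_congr rfl fun ψ _ => ?_
  simp only [← mul_assoc, ← Finset.sum_mul, ← Finset.prod_mul_distrib]
  rw [← Fintype.piFinset_univ,
    ← Finset.prod_univ_sum (fun _ => Finset.univ) fun j c => W j c * if ψ (ε j) = c then 1 else 0]
  simp

end VertexModels

/-- Equation (18): `g • p_h(F) = p_{g h}(F)` for every `g ∈ O_n`. -/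
theorem tact_ph_eq_ph_dualAct (𝔽 : Type) [Field 𝔽] (n : ℕ) (h : VertexModel 𝔽 n)
    (g : Matrix (Fin n) (Fin n) 𝔽) (hg : g ∈ orthSet 𝔽 n)
    (k : ℕ) (F : Fragment k) :
    tact g k (ph h F) = ph (dualAct g h) F := by
  funext φ
  have hgT : g * g.transpose = 1 := mul_eq_one_comm.mp hg
  have hδ : (fun j c => ∑ d, g c d * g (φ j) d) =
      fun j c => if c = φ j then (1 : 𝔽) else 0 := by
    funext j c
    simpa [Matrix.mul_apply, Matrix.one_apply] using congrFun (congrFun hgT c) (φ j)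
  calc tact g k (ph h F) φ
      = ∑ φ', (∏ j, g (φ j) (φ' j)) * hphi h F φ' := rfl
    _ = weightedSum h F X (fun j => g (φ j)) := by
        simp only [hphi_eq_weightedSum]
        exact sum_prod_mul_weightedSum h F X fun j => g (φ j)
    _ = hphi (dualAct g h) F φ := by
        rw [hphi_dualAct, ← weightedSum_orthogonal h F hg, hδ]
end

section
/- For every vertex model h ∈ R* and every g ∈ O_n, the partition functions of h and of gh coincide: f_{gh}(G) = f_h(G) for all graphs G ∈ 𝒢. -/
/-!
Formalization framework for "Partition functions of vertex models /
edge connection matrices" (Regts–Draisma style).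

Graphs and fragments are finite multigraphs (allowing multiple edges, loops
and circles); a `k`-fragment additionally has `k` labelled open ends.  We
encode a `k`-fragment by a number `nv` of internal vertices, a number `ne`
of edges, and for each edge the multiset of its endpoints, each endpoint
being either an internal vertex (`Sum.inl`) or an open-end label
(`Sum.inr`).  Every edge has `2` endpoints (counted with multiplicity; a
loop at `v` lists `v` twice) or `0` endpoints (a circle), and every label
occurs exactly once in total (the open ends have degree one).
-/

open MvPolynomial

open VertexModels

namespace VertexModels

open MvPolynomial

/-- A family of functionals on `R`, indexed by `ι`, extends to a functional on
`R^{⊗ ι} = 𝔽[x_{v,i}]`. -/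
theorem exists_prodFunctional {𝔽 ι σ : Type} [Field 𝔽] [Fintype ι] [DecidableEq ι]
    (h : MvPolynomial σ 𝔽 →ₗ[𝔽] 𝔽) :
    ∃ H : MvPolynomial (ι × σ) 𝔽 →ₗ[𝔽] 𝔽, ∀ p : ι → MvPolynomial σ 𝔽,
      H (∏ v, rename (Prod.mk v) (p v)) = ∏ v, h (p v) := by
  let H : MvPolynomial (ι × σ) 𝔽 →ₗ[𝔽] 𝔽 := (basisMonomials (ι × σ) 𝔽).constr 𝔽
    fun d => ∏ v, h (monomial (d.comapDomain (Prod.mk v) (Prod.mk_right_injective v).injOn) 1)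
  refine ⟨H, fun p => ?_⟩
  let A : MultilinearMap 𝔽 (fun _ : ι => MvPolynomial σ 𝔽) 𝔽 :=
    H.compMultilinearMap ((MultilinearMap.mkPiAlgebra 𝔽 ι _).compLinearMap
      fun v => (rename (R := 𝔽) (Prod.mk v : σ → ι × σ)).toLinearMap)
  let B : MultilinearMap 𝔽 (fun _ : ι => MvPolynomial σ 𝔽) 𝔽 :=
    (MultilinearMap.mkPiAlgebra 𝔽 ι 𝔽).compLinearMap fun _ => h
  suffices hAB : A = B from DFunLike.congr_fun hAB p
  refine Module.Basis.ext_multilinear (fun _ => basisMonomials σ 𝔽) fun d => ?_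
  have hmon : (∏ v, rename (Prod.mk v) (monomial (d v) (1 : 𝔽)) : MvPolynomial (ι × σ) 𝔽)
      = basisMonomials (ι × σ) 𝔽 (∑ v, (d v).mapDomain (Prod.mk v)) := by
    simp only [rename_monomial, coe_basisMonomials]
    exact (monomial_sum_one _ _).symm
  simp only [A, B, LinearMap.compMultilinearMap_apply, MultilinearMap.compLinearMap_apply,
    MultilinearMap.mkPiAlgebra_apply, AlgHom.toLinearMap_apply, coe_basisMonomials]
  rw [hmon, Module.Basis.constr_basis]
  refine Finset.prod_congr rfl fun v _ => ?_
  congr 3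
  ext i
  rw [Finsupp.comapDomain_apply, Finsupp.finsetSum_apply, Finset.sum_eq_single v]
  · exact Finsupp.mapDomain_apply (Prod.mk_right_injective v) _ _
  · intro w _ hw
    refine Finsupp.mapDomain_of_notMem_range _ _ ?_
    rintro ⟨j, hj⟩
    exact hw (congrArg Prod.fst hj)
  · simp

/-- The substitution `p ↦ p ∘ g` applied simultaneously to all the blocks of variables. -/
noncomputable def blockSub {𝔽 : Type} [Field 𝔽] {n : ℕ} (ι : Type)
    (g : Matrix (Fin n) (Fin n) 𝔽) :
    MvPolynomial (ι × Fin n) 𝔽 →ₐ[𝔽] MvPolynomial (ι × Fin n) 𝔽 :=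
  aeval fun p => ∑ j, C (g p.2 j) * X (p.1, j)

theorem rename_polSub {𝔽 ι : Type} [Field 𝔽] {n : ℕ} (g : Matrix (Fin n) (Fin n) 𝔽) (v : ι)
    (p : MvPolynomial (Fin n) 𝔽) :
    rename (Prod.mk v) (polSub g p) = blockSub ι g (rename (Prod.mk v) p) := by
  have : (rename (R := 𝔽) (Prod.mk v : Fin n → ι × Fin n)).comp
        (aeval fun i => ∑ j, C (g i j) * X j)
      = (blockSub ι g).comp (rename (Prod.mk v)) := by
    ext1 i
    simp [blockSub, map_sum]
  exact DFunLike.congr_fun this p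

theorem blockSub_sum_X_mul_X {𝔽 ι : Type} [Field 𝔽] {n : ℕ} {g : Matrix (Fin n) (Fin n) 𝔽}
    (hg : g ∈ orthSet 𝔽 n) (u w : ι) :
    blockSub ι g (∑ i, X (u, i) * X (w, i)) = ∑ i, X (u, i) * X (w, i) := by
  have hcol (j k : Fin n) : ∑ i, g i j * g i k = if j = k then 1 else 0 := by
    have := congrFun (congrFun (show g.transpose * g = 1 from hg) j) k
    simpa [Matrix.mul_apply, Matrix.one_apply] using this
  calc blockSub ι g (∑ i, X (u, i) * X (w, i))
      = ∑ i, ∑ j, ∑ k, C (g i j * g i k) * (X (u, j) * X (w, k)) := by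
        simp only [blockSub, map_sum, map_mul, aeval_X, Finset.sum_mul_sum]
        refine Finset.sum_congr rfl fun i _ => Finset.sum_congr rfl fun j _ =>
          Finset.sum_congr rfl fun k _ => by ring
    _ = ∑ j, ∑ k, C (∑ i, g i j * g i k) * (X (u, j) * X (w, k)) := by
        rw [Finset.sum_comm]
        refine Finset.sum_congr rfl fun j _ => ?_
        rw [Finset.sum_comm]
        refine Finset.sum_congr rfl fun k _ => ?_
        rw [map_sum, Finset.sum_mul]
    _ = ∑ i, X (u, i) * X (w, i) := by
        simp [hcol, apply_ite C, ite_mul]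

/-- The polynomial `∑ i, ∏ v, x_{v,i}` (`v` ranging over the endpoints of the edge `e`). -/
noncomputable def edgePoly (𝔽 : Type) [Field 𝔽] (n : ℕ) (G : Graph) (e : Fin G.ne) :
    MvPolynomial (Fin G.nv × Fin n) 𝔽 :=
  ∑ i, ∏ v, X (v, i) ^ (G.inc e).count (Sum.inl v)

theorem blockSub_edgePoly {𝔽 : Type} [Field 𝔽] {n : ℕ} {g : Matrix (Fin n) (Fin n) 𝔽}
    (hg : g ∈ orthSet 𝔽 n) (G : Graph) (e : Fin G.ne) :
    blockSub _ g (edgePoly 𝔽 n G e) = edgePoly 𝔽 n G e := by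
  rcases G.card_inc e with h2 | h0
  · obtain ⟨a, b, hab⟩ := Multiset.card_eq_two.mp h2
    rcases a with u | a
    · rcases b with w | b
      · have : edgePoly 𝔽 n G e = ∑ i, X (u, i) * X (w, i) := by
          simp only [edgePoly, hab, Multiset.insert_eq_cons, Multiset.count_cons,
            Multiset.count_singleton, pow_add, Finset.prod_mul_distrib, Sum.inl.injEq, pow_ite,
            pow_one, pow_zero, Finset.prod_ite_eq', Finset.mem_univ, if_true, mul_comm]
        rw [this, blockSub_sum_X_mul_X hg]
      · exact b.elim0
    · exact a.elim0
  · simp [edgePoly, Multiset.card_eq_zero.mp h0]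

theorem sum_prod_rename_monomialAt {𝔽 : Type} [Field 𝔽] {n : ℕ} (G : Graph) :
    ∑ ψ : Fin G.ne → Fin n, ∏ v, rename (Prod.mk v) (monomialAt (𝔽 := 𝔽) G ψ v)
      = ∏ e, edgePoly 𝔽 n G e := by
  simp only [edgePoly, Finset.prod_univ_sum, Fintype.piFinset_univ]
  refine Finset.sum_congr rfl fun ψ _ => ?_
  rw [Finset.prod_comm]
  simp [monomialAt, map_prod]

end VertexModels

/-- `f_{g h} = f_h` for every `g ∈ O_n`: the partition function only depends
on the `O_n`-orbit of the vertex model. -/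
theorem partitionFun_dualAct (𝔽 : Type) [Field 𝔽] (n : ℕ) (h : VertexModel 𝔽 n)
    (g : Matrix (Fin n) (Fin n) 𝔽) (hg : g ∈ orthSet 𝔽 n) (G : Graph) :
    partitionFun (dualAct g h) G = partitionFun h G := by
  obtain ⟨H, hH⟩ := exists_prodFunctional (ι := Fin G.nv) h
  have hG : partitionFun h G = H (∏ e, edgePoly 𝔽 n G e) := by
    rw [← sum_prod_rename_monomialAt, map_sum]
    exact Finset.sum_congr rfl fun ψ _ => (hH _).symm
  have hgG : partitionFun (dualAct g h) G = H (blockSub _ g (∏ e, edgePoly 𝔽 n G e)) := by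
    rw [← sum_prod_rename_monomialAt, map_sum, map_sum]
    refine Finset.sum_congr rfl fun ψ _ => ?_
    simp only [map_prod, ← rename_polSub]
    exact (hH fun v => polSub g (monomialAt G ψ v)).symm
  rw [hG, hgG, map_prod]
  simp only [blockSub_edgePoly hg]
end

section
/- Let 𝔽 be an algebraically closed field of characteristic zero, let u_1,…,u_m be distinct vectors in V, let a_1,…,a_m be nonzero elements of 𝔽, and define h ∈ R* by h(p) = Σ_{i=1}^m a_i p(u_i). Then the following are equivalent: (i) the O_n-orbit of h_e is Zariski-closed for all sufficiently large e; (ii) the O_n-orbit of (u_1,…,u_m) in V^m is Zariski-closed; (iii) the restriction of the bilinear form to the span of u_1,…,u_m is nondegenerate. -/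
/-!
Formalization framework for "Partition functions of vertex models /
edge connection matrices" (Regts–Draisma style).

Graphs and fragments are finite multigraphs (allowing multiple edges, loops
and circles); a `k`-fragment additionally has `k` labelled open ends.  We
encode a `k`-fragment by a number `nv` of internal vertices, a number `ne`
of edges, and for each edge the multiset of its endpoints, each endpoint
being either an internal vertex (`Sum.inl`) or an open-end label
(`Sum.inr`).  Every edge has `2` endpoints (counted with multiplicity; a
loop at `v` lists `v` twice) or `0` endpoints (a circle), and every label
occurs exactly once in total (the open ends have degree one).
-/

open MvPolynomial

open VertexModels

namespace VertexModels

open Matrix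

/-- A polynomial curve whose points at nonzero parameters lie in a Zariski-closed set has its
point at parameter zero in that set. -/
theorem IsZarClosed.eval_zero_mem {𝔽 : Type} [Field 𝔽] [Infinite 𝔽] {ι : Type}
    {S : Set (ι → 𝔽)} (hS : IsZarClosed S) (c : ι → Polynomial 𝔽)
    (hc : ∀ t : 𝔽, t ≠ 0 → (fun i => (c i).eval t) ∈ S) :
    (fun i => (c i).eval 0) ∈ S := by
  obtain ⟨P, rfl⟩ := hS
  intro p hp
  have key : ∀ (p : MvPolynomial ι 𝔽) (t : 𝔽), (MvPolynomial.aeval c p).eval t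
      = MvPolynomial.eval (fun i => (c i).eval t) p := by
    intro p t
    induction p using MvPolynomial.induction_on with
    | C a => simp
    | add p q hp hq => simp [hp, hq]
    | mul_X p i hp => simp [hp]
  have hz : Polynomial.X * MvPolynomial.aeval c p = 0 := by
    refine Polynomial.funext fun t => ?_
    by_cases ht : t = 0
    · simp [ht]
    · simp [key, hc t ht p hp]
  have h0 : MvPolynomial.aeval c p = 0 :=
    (mul_eq_zero.mp hz).resolve_left Polynomial.X_ne_zero
  rw [← key, h0, Polynomial.eval_zero]

/-- Orthogonal matrices preserve the dot product. -/
theorem dotProduct_mulVec_of_mem_orthSet {𝔽 : Type} [Field 𝔽] {n : ℕ}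
    {g : Matrix (Fin n) (Fin n) 𝔽} (hg : g ∈ orthSet 𝔽 n) (x y : Fin n → 𝔽) :
    (g *ᵥ x) ⬝ᵥ (g *ᵥ y) = x ⬝ᵥ y := by
  have hg' : gᵀ * g = 1 := hg
  rw [dotProduct_mulVec, vecMul_mulVec, ← dotProduct_mulVec, hg', one_mulVec]

/-- A matrix preserving the dot product is orthogonal. -/
theorem mem_orthSet_of_dotProduct_mulVec {𝔽 : Type} [Field 𝔽] {n : ℕ}
    {g : Matrix (Fin n) (Fin n) 𝔽}
    (hg : ∀ x y : Fin n → 𝔽, (g *ᵥ x) ⬝ᵥ (g *ᵥ y) = x ⬝ᵥ y) : g ∈ orthSet 𝔽 n := by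
  change gᵀ * g = 1
  ext i j
  have h := hg (Pi.single i 1) (Pi.single j 1)
  rw [dotProduct_mulVec, vecMul_mulVec, ← dotProduct_mulVec] at h
  simpa [Matrix.one_apply, Pi.single_apply, eq_comm] using h

theorem mulVec_injective_of_mem_orthSet {𝔽 : Type} [Field 𝔽] {n : ℕ}
    {g : Matrix (Fin n) (Fin n) 𝔽} (hg : g ∈ orthSet 𝔽 n) : Function.Injective g.mulVec := by
  have hg' : gᵀ * g = 1 := hg
  refine Function.LeftInverse.injective (g := gᵀ.mulVec) fun x => ?_
  rw [mulVec_mulVec, hg', one_mulVec]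

/-- The form restricted to `W` is nondegenerate. -/
def NondegOn {𝔽 : Type} [Field 𝔽] {n : ℕ} (W : Submodule 𝔽 (Fin n → 𝔽)) : Prop :=
  ∀ x ∈ W, (∀ y ∈ W, x ⬝ᵥ y = 0) → x = 0

/-- The orthogonal complement with respect to the dot product. -/
def dotOrth {𝔽 : Type} [Field 𝔽] {n : ℕ} (W : Submodule 𝔽 (Fin n → 𝔽)) :
    Submodule 𝔽 (Fin n → 𝔽) :=
  LinearMap.BilinForm.orthogonal (dotProductBilin 𝔽 𝔽 : LinearMap.BilinForm 𝔽 (Fin n → 𝔽)) W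

theorem mem_dotOrth {𝔽 : Type} [Field 𝔽] {n : ℕ} {W : Submodule 𝔽 (Fin n → 𝔽)}
    {x : Fin n → 𝔽} : x ∈ dotOrth W ↔ ∀ y ∈ W, y ⬝ᵥ x = 0 := Iff.rfl

theorem isCompl_dotOrth {𝔽 : Type} [Field 𝔽] {n : ℕ} {W : Submodule 𝔽 (Fin n → 𝔽)}
    (hW : NondegOn W) : IsCompl W (dotOrth W) := by
  have hr : (dotProductBilin 𝔽 𝔽 : LinearMap.BilinForm 𝔽 (Fin n → 𝔽)).IsRefl :=
    fun x y h => by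
      change y ⬝ᵥ x = 0
      rw [dotProduct_comm]; exact h
  refine (LinearMap.BilinForm.isCompl_orthogonal_iff_disjoint hr).2 ?_
  rw [Submodule.disjoint_def]
  exact fun x hx hx' => hW x hx fun y hy => by rw [dotProduct_comm]; exact hx' y hy

theorem nondegOn_dotOrth {𝔽 : Type} [Field 𝔽] {n : ℕ} {W : Submodule 𝔽 (Fin n → 𝔽)}
    (hW : NondegOn W) : NondegOn (dotOrth W) := by
  intro x hx h
  refine dotProduct_eq_zero x fun y => ?_
  obtain ⟨p, hp, q, hq, rfl⟩ := Submodule.mem_sup.1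
    ((isCompl_dotOrth hW).sup_eq_top ▸ Submodule.mem_top : y ∈ W ⊔ dotOrth W)
  rw [dotProduct_add, h q hq, dotProduct_comm, mem_dotOrth.1 hx p hp, add_zero]

theorem exists_linearEquiv_dotProduct {𝔽 : Type} [Field 𝔽] [IsAlgClosed 𝔽] [CharZero 𝔽]
    {n r : ℕ} {W : Submodule 𝔽 (Fin n → 𝔽)} (hW : NondegOn W) (hr : Module.finrank 𝔽 W = r) :
    ∃ e : W ≃ₗ[𝔽] (Fin r → 𝔽), ∀ x y : W, e x ⬝ᵥ e y = (x : Fin n → 𝔽) ⬝ᵥ y := by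
  subst hr
  have : Invertible (2 : 𝔽) := invertibleOfNonzero two_ne_zero
  let B : LinearMap.BilinForm 𝔽 W :=
    LinearMap.BilinForm.restrict (dotProductBilin 𝔽 𝔽) W
  have hB : ∀ x y : W, B x y = (x : Fin n → 𝔽) ⬝ᵥ y := fun _ _ => rfl
  have hs : ∀ x y : W, B x y = B y x := fun x y => by rw [hB, hB, dotProduct_comm]
  have ha : QuadraticMap.associated (R := 𝔽) B.toQuadraticMap = B :=
    QuadraticMap.associated_left_inverse 𝔽 hs
  obtain ⟨e⟩ := QuadraticForm.equivalent_weightedSumSquares_of_isAlgClosed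
    B.toQuadraticMap (by
      rw [ha]
      intro x hx
      exact Subtype.ext (hW x x.2 fun y hy => hx ⟨y, hy⟩))
  have hq : ∀ x : W, e x ⬝ᵥ e x = (x : Fin n → 𝔽) ⬝ᵥ x := by
    intro x
    have h : QuadraticMap.weightedSumSquares 𝔽 1 (e x) = B.toQuadraticMap x := e.map_app x
    rw [QuadraticMap.weightedSumSquares_apply, LinearMap.BilinMap.toQuadraticMap_apply, hB] at h
    rw [← h]
    simp [dotProduct]
  refine ⟨e.toLinearEquiv, fun x y => ?_⟩
  change e x ⬝ᵥ e y = _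
  have h := hq (x + y)
  have hadd : e (x + y) = e x + e y := map_add e.toLinearEquiv x y
  rw [hadd] at h
  simp only [Submodule.coe_add, add_dotProduct, dotProduct_add, hq] at h
  rw [dotProduct_comm (e y), dotProduct_comm (y : Fin n → 𝔽) x] at h
  have h2 : (2 : 𝔽) * (e x ⬝ᵥ e y) = 2 * ((x : Fin n → 𝔽) ⬝ᵥ y) := by linear_combination h
  exact mul_left_cancel₀ two_ne_zero h2

/-- Witt extension for nondegenerate subspaces over an algebraically closed field. -/
theorem exists_mem_orthSet_extending {𝔽 : Type} [Field 𝔽] [IsAlgClosed 𝔽] [CharZero 𝔽]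
    {n : ℕ} {W : Submodule 𝔽 (Fin n → 𝔽)} (hW : NondegOn W)
    (T : W →ₗ[𝔽] (Fin n → 𝔽))
    (hT : ∀ x y : W, T x ⬝ᵥ T y = (x : Fin n → 𝔽) ⬝ᵥ y) :
    ∃ g ∈ orthSet 𝔽 n, ∀ x : W, g *ᵥ (x : Fin n → 𝔽) = T x := by
  have hinj : Function.Injective T := by
    rw [← LinearMap.ker_eq_bot, LinearMap.ker_eq_bot']
    intro x hx
    refine Subtype.ext (hW x x.2 fun y hy => ?_)
    rw [← hT x ⟨y, hy⟩, hx, zero_dotProduct]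
  have hW' : NondegOn (LinearMap.range T) := by
    rintro _ ⟨x, rfl⟩ h
    have : x = 0 := Subtype.ext (hW x x.2 fun y hy => by
      rw [← hT x ⟨y, hy⟩]; exact h _ ⟨_, rfl⟩)
    rw [this, map_zero]
  have hc := isCompl_dotOrth hW
  have hc' := isCompl_dotOrth hW'
  have hdim : Module.finrank 𝔽 (dotOrth (LinearMap.range T)) = Module.finrank 𝔽 (dotOrth W) := by
    have h1 := Submodule.finrank_add_eq_of_isCompl hc
    have h2 := Submodule.finrank_add_eq_of_isCompl hc'
    rw [LinearMap.finrank_range_of_inj hinj] at h2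
    omega
  obtain ⟨e, he⟩ := exists_linearEquiv_dotProduct (nondegOn_dotOrth hW) rfl
  obtain ⟨e', he'⟩ := exists_linearEquiv_dotProduct (nondegOn_dotOrth hW') hdim
  let L : (Fin n → 𝔽) →ₗ[𝔽] (Fin n → 𝔽) :=
    LinearMap.ofIsCompl hc T
      ((dotOrth (LinearMap.range T)).subtype ∘ₗ (e.trans e'.symm).toLinearMap)
  have hL₁ : ∀ x : W, L x = T x := fun x => LinearMap.ofIsCompl_apply_left hc x
  have hL₂ : ∀ x : dotOrth W, L x = e'.symm (e x) := fun x => LinearMap.ofIsCompl_apply_right hc x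
  refine ⟨LinearMap.toMatrix' L, mem_orthSet_of_dotProduct_mulVec fun x y => ?_, fun x => ?_⟩
  · have hdec : ∀ x : Fin n → 𝔽, ∃ (p : W) (q : dotOrth W), (p : Fin n → 𝔽) + q = x := by
      intro x
      obtain ⟨p, hp, q, hq, h⟩ := Submodule.mem_sup.1
        (hc.sup_eq_top ▸ Submodule.mem_top : x ∈ W ⊔ dotOrth W)
      exact ⟨⟨p, hp⟩, ⟨q, hq⟩, h⟩
    rw [LinearMap.toMatrix'_mulVec, LinearMap.toMatrix'_mulVec]
    obtain ⟨p, q, rfl⟩ := hdec x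
    obtain ⟨p', q', rfl⟩ := hdec y
    have hqq : (e'.symm (e q) : Fin n → 𝔽) ⬝ᵥ (e'.symm (e q') : Fin n → 𝔽)
        = (q : Fin n → 𝔽) ⬝ᵥ q' := by
      rw [← he', LinearEquiv.apply_symm_apply, LinearEquiv.apply_symm_apply, he]
    have h1 : ∀ (p : W) (q : dotOrth W), T p ⬝ᵥ (e'.symm (e q) : Fin n → 𝔽) = 0 :=
      fun p q => mem_dotOrth.1 (e'.symm (e q)).2 _ ⟨p, rfl⟩
    have h2 : ∀ (p : W) (q : dotOrth W), (p : Fin n → 𝔽) ⬝ᵥ (q : Fin n → 𝔽) = 0 :=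
      fun p q => mem_dotOrth.1 q.2 _ p.2
    simp only [map_add, hL₁, hL₂, add_dotProduct, dotProduct_add, hqq, hT, h1, h2]
    rw [dotProduct_comm _ (T p'), h1, dotProduct_comm (q : Fin n → 𝔽) p', h2]
  · rw [LinearMap.toMatrix'_mulVec, hL₁]

theorem spinModel_apply {𝔽 : Type} [Field 𝔽] {n m : ℕ} (u : Fin m → (Fin n → 𝔽))
    (a : Fin m → 𝔽) (p : MvPolynomial (Fin n) 𝔽) :
    spinModel u a p = ∑ i, a i * MvPolynomial.eval (u i) p := by
  simp [spinModel, MvPolynomial.aeval_eq_eval]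

theorem dualAct_spinModel {𝔽 : Type} [Field 𝔽] {n m : ℕ} (g : Matrix (Fin n) (Fin n) 𝔽)
    (u : Fin m → (Fin n → 𝔽)) (a : Fin m → 𝔽) :
    dualAct g (spinModel u a) = spinModel (fun i => g *ᵥ u i) a := by
  refine LinearMap.ext fun p => ?_
  have h : ∀ v : Fin n → 𝔽,
      MvPolynomial.eval v (polSub g p) = MvPolynomial.eval (g *ᵥ v) p := by
    intro v
    induction p using MvPolynomial.induction_on with
    | C c => simp [polSub]
    | add p q hp hq => rw [map_add, map_add, map_add, hp, hq]
    | mul_X p i hp =>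
      have hm : polSub g (p * X i) = polSub g p * ∑ j, C (g i j) * X j := by simp [polSub]
      rw [hm, map_mul, hp, map_mul]
      simp [mulVec, dotProduct]
  change spinModel u a (polSub g p) = _
  simp only [spinModel_apply, h]

/-- A point outside a finite set is separated from it by a polynomial of degree at most the
size of the set. -/
theorem exists_totalDegree_le_card_eval_ne_zero {𝔽 ι : Type} [Field 𝔽] (T : Finset (ι → 𝔽))
    {z : ι → 𝔽} (hz : z ∉ T) : ∃ p : MvPolynomial ι 𝔽, p.totalDegree ≤ T.card ∧
      MvPolynomial.eval z p ≠ 0 ∧ ∀ t ∈ T, MvPolynomial.eval t p = 0 := by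
  have h : ∀ t : T, ∃ i, z i ≠ t.1 i := fun t => by
    by_contra! h
    exact hz (funext h ▸ t.2)
  choose i hi using h
  refine ⟨∏ t : T, (X (i t) - C (t.1 (i t))), ?_, ?_, fun t ht => ?_⟩
  · refine (totalDegree_finsetProd _ _).trans ?_
    refine (Finset.sum_le_card_nsmul _ _ 1 fun t _ => ?_).trans (by simp)
    refine (totalDegree_sub_C_le _ _).trans ?_
    rw [totalDegree_X]
  · rw [map_prod, Finset.prod_ne_zero_iff]
    intro t _
    simpa [sub_eq_zero] using hi t
  · rw [map_prod]
    exact Finset.prod_eq_zero (Finset.mem_univ ⟨t, ht⟩) (by simp)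

/-- If two spin models agree in low degrees, then each point of one, if the points are distinct
with nonzero coefficients, is a point of the other. -/
theorem exists_eq_of_spinModel_eq {𝔽 : Type} [Field 𝔽] {n m e : ℕ} (he : m + m ≤ e)
    {v w : Fin m → (Fin n → 𝔽)} {a b : Fin m → 𝔽} (hw : Function.Injective w)
    (ha : ∀ i, a i ≠ 0)
    (h : ∀ d : LowDeg n e, spinModel w a (MvPolynomial.monomial d.1 1)
      = spinModel v b (MvPolynomial.monomial d.1 1)) (i : Fin m) : ∃ j, w i = v j := by
  classical
  by_contra! hi
  have hlow : ∀ p : MvPolynomial (Fin n) 𝔽, p.totalDegree ≤ e →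
      spinModel w a p = spinModel v b p := by
    intro p hp
    have hm : ∀ d, MvPolynomial.monomial d (coeff d p)
        = coeff d p • MvPolynomial.monomial d (1 : 𝔽) := fun d => by simp [smul_monomial]
    rw [p.as_sum, map_sum, map_sum]
    refine Finset.sum_congr rfl fun d hd => ?_
    rw [hm, map_smul, map_smul, h ⟨d, (le_totalDegree hd).trans hp⟩]
  obtain ⟨p, hdeg, hpi, hp⟩ := exists_totalDegree_le_card_eval_ne_zero
    (Finset.univ.image v ∪ (Finset.univ.erase i).image w) (z := w i) (by
      simp only [Finset.mem_union, Finset.mem_image, Finset.mem_univ, true_and, Finset.mem_erase,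
        and_true, not_or, not_exists, not_and]
      exact ⟨fun j hj => hi j hj.symm, fun j hj hj' => hj (hw hj')⟩)
  have hcard : (Finset.univ.image v ∪ (Finset.univ.erase i).image w).card ≤ m + m := by
    refine (Finset.card_union_le _ _).trans (add_le_add ?_ ?_)
    · exact Finset.card_image_le.trans (by simp)
    · exact Finset.card_image_le.trans ((Finset.card_erase_le).trans (by simp))
  have heq := hlow p (hdeg.trans (hcard.trans he))
  rw [spinModel_apply, spinModel_apply, Finset.sum_eq_single i,
    Finset.sum_eq_zero (f := fun j => b j * _)] at heq
  · exact mul_ne_zero (ha i) hpi heq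
  · intro j _
    rw [hp (v j) (by simp), mul_zero]
  · intro j _ hj
    rw [hp (w j) (Finset.mem_union_right _ (Finset.mem_image_of_mem w (by simp [hj]))), mul_zero]
  · simp

/-- A nonzero isotropic vector `x` is scaled by a one-parameter group of orthogonal matrices
acting on the hyperplane orthogonal to `x` by transvection-like maps. -/
theorem exists_orthSet_scaling {𝔽 : Type} [Field 𝔽] [CharZero 𝔽] {n : ℕ} {x : Fin n → 𝔽}
    (hx : x ≠ 0) (hxx : x ⬝ᵥ x = 0) : ∃ y : Fin n → 𝔽, x ⬝ᵥ y = 1 ∧ ∀ t : 𝔽, t ≠ 0 →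
      ∃ g ∈ orthSet 𝔽 n, ∀ w, w ⬝ᵥ x = 0 → g *ᵥ w = w + ((t - 1) * (w ⬝ᵥ y)) • x := by
  obtain ⟨i, hi⟩ := Function.ne_iff.1 hx
  set y₀ : Fin n → 𝔽 := Pi.single i (x i)⁻¹ with hy₀
  have hxy₀ : x ⬝ᵥ y₀ = 1 := by rw [hy₀, dotProduct_single]; exact mul_inv_cancel₀ hi
  set y : Fin n → 𝔽 := y₀ - ((y₀ ⬝ᵥ y₀) / 2) • x with hy
  have hxy : x ⬝ᵥ y = 1 := by rw [hy, dotProduct_sub, dotProduct_smul, hxx, hxy₀]; simp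
  have hyy : y ⬝ᵥ y = 0 := by
    rw [hy]
    simp only [dotProduct_sub, dotProduct_smul, sub_dotProduct, smul_dotProduct, hxx, hxy₀,
      dotProduct_comm y₀ x, smul_eq_mul]
    ring
  refine ⟨y, hxy, fun t ht => ?_⟩
  let g : Matrix (Fin n) (Fin n) 𝔽 := 1 + (t - 1) • vecMulVec x y + (t⁻¹ - 1) • vecMulVec y x
  have hg : ∀ w, g *ᵥ w = w + ((t - 1) * (w ⬝ᵥ y)) • x + ((t⁻¹ - 1) * (w ⬝ᵥ x)) • y := by
    intro w
    simp only [g, add_mulVec, one_mulVec, smul_mulVec, vecMulVec_mulVec]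
    ext k
    simp [dotProduct_comm w]
    ring
  refine ⟨g, mem_orthSet_of_dotProduct_mulVec fun v w => ?_, fun w hw => by simp [hg, hw]⟩
  rw [hg, hg]
  simp only [dotProduct_add, dotProduct_smul, add_dotProduct, smul_dotProduct, hxx, hxy, hyy,
    dotProduct_comm y x, dotProduct_comm x w, dotProduct_comm y w, smul_eq_mul]
  field_simp
  ring

/-- An orthogonal transformation cannot map a spanning set of `span u` into a projection of
`u` along a vector of `span u`. -/
theorem not_forall_exists_mulVec_eq_sub {𝔽 : Type} [Field 𝔽] {n m : ℕ}
    {u : Fin m → (Fin n → 𝔽)} {x y : Fin n → 𝔽} (hx : x ∈ Submodule.span 𝔽 (Set.range u))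
    (hxy : x ⬝ᵥ y = 1) {g : Matrix (Fin n) (Fin n) 𝔽} (hg : g ∈ orthSet 𝔽 n) :
    ¬ ∀ i, ∃ j, g *ᵥ u i = u j - (u j ⬝ᵥ y) • x := by
  intro h
  set W := Submodule.span 𝔽 (Set.range u) with hW
  let π : (Fin n → 𝔽) →ₗ[𝔽] (Fin n → 𝔽) :=
    LinearMap.id - ((dotProductBilin 𝔽 𝔽).flip y : (Fin n → 𝔽) →ₗ[𝔽] 𝔽).smulRight x
  have hπ : ∀ w, π w = w - (w ⬝ᵥ y) • x := fun w => rfl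
  have hle : W.map g.mulVecLin ≤ W.map π := by
    rw [hW, Submodule.map_span_le]
    rintro _ ⟨i, rfl⟩
    obtain ⟨j, hj⟩ := h i
    rw [mulVecLin_apply, hj, ← hπ]
    exact Submodule.mem_map_of_mem (Submodule.subset_span ⟨j, rfl⟩)
  have h1 : Module.finrank 𝔽 (W.map g.mulVecLin) = Module.finrank 𝔽 W :=
    (Submodule.equivMapOfInjective g.mulVecLin
      (mulVec_injective_of_mem_orthSet hg) W).finrank_eq.symm
  have h2 := LinearMap.finrank_range_add_finrank_ker (π.domRestrict W)
  rw [LinearMap.range_domRestrict] at h2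
  have h3 := Submodule.finrank_mono hle
  have h4 : (LinearMap.ker (π.domRestrict W)) = ⊥ := by
    rw [← Submodule.finrank_eq_zero (R := 𝔽)]
    omega
  have h5 : (⟨x, hx⟩ : W) = 0 := LinearMap.ker_eq_bot'.1 h4 _ (by
    rw [LinearMap.domRestrict_apply, hπ]; simp [hxy])
  have h6 : x = 0 := congrArg Subtype.val h5
  rw [h6, zero_dotProduct] at hxy
  exact zero_ne_one hxy

theorem nondegOn_of_isZarClosed_restOrbit {𝔽 : Type} [Field 𝔽] [CharZero 𝔽] {n m e : ℕ}
    {u : Fin m → (Fin n → 𝔽)} (hu : Function.Injective u) {a : Fin m → 𝔽} (ha : ∀ i, a i ≠ 0)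
    (he : m + m ≤ e) (hcl : IsZarClosed (restOrbit (spinModel u a) e)) :
    NondegOn (Submodule.span 𝔽 (Set.range u)) := by
  intro x hx hort
  by_contra hx0
  obtain ⟨y, hxy, hscale⟩ := exists_orthSet_scaling hx0 (hort x hx)
  have hux : ∀ i, u i ⬝ᵥ x = 0 := fun i => by
    rw [dotProduct_comm]; exact hort _ (Submodule.subset_span ⟨i, rfl⟩)
  have hmem := hcl.eval_zero_mem
    (fun d => ∑ i, Polynomial.C (a i) * ∏ s, (Polynomial.C (u i s)
      + (Polynomial.X - 1) * Polynomial.C ((u i ⬝ᵥ y) * x s)) ^ (d.1 s)) (by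
    intro t ht
    obtain ⟨g, hg, hgw⟩ := hscale t ht
    refine ⟨g, hg, fun d => ?_⟩
    rw [dualAct_spinModel, spinModel_apply]
    simp [MvPolynomial.eval_monomial, Finsupp.prod_fintype, Polynomial.eval_finsetSum,
      Polynomial.eval_prod, hgw _ (hux _), mul_assoc])
  obtain ⟨g, hg, h⟩ := hmem
  refine not_forall_exists_mulVec_eq_sub hx hxy hg (exists_eq_of_spinModel_eq
    (v := fun j => u j - (u j ⬝ᵥ y) • x) (b := a) he
    ((mulVec_injective_of_mem_orthSet hg).comp hu) ha fun d => ?_)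
  rw [← dualAct_spinModel, ← h d, spinModel_apply]
  simp [MvPolynomial.eval_monomial, Finsupp.prod_fintype, Polynomial.eval_finsetSum,
      Polynomial.eval_prod, sub_eq_add_neg]

theorem nondegOn_of_isZarClosed_vecOrbit {𝔽 : Type} [Field 𝔽] [CharZero 𝔽] {n m : ℕ}
    {u : Fin m → (Fin n → 𝔽)} (hcl : IsZarClosed (vecOrbit u)) :
    NondegOn (Submodule.span 𝔽 (Set.range u)) := by
  intro x hx hort
  by_contra hx0
  obtain ⟨y, hxy, hscale⟩ := exists_orthSet_scaling hx0 (hort x hx)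
  have hux : ∀ i, u i ⬝ᵥ x = 0 := fun i => by
    rw [dotProduct_comm]; exact hort _ (Submodule.subset_span ⟨i, rfl⟩)
  have hmem := hcl.eval_zero_mem
    (fun p => Polynomial.C (u p.1 p.2)
      + (Polynomial.X - 1) * Polynomial.C ((u p.1 ⬝ᵥ y) * x p.2)) (by
    intro t ht
    obtain ⟨g, hg, hgw⟩ := hscale t ht
    exact ⟨g, hg, fun p => by simp [hgw _ (hux _), mul_assoc]⟩)
  obtain ⟨g, hg, h⟩ := hmem
  refine not_forall_exists_mulVec_eq_sub hx hxy hg fun i => ⟨i, funext fun s => ?_⟩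
  rw [← h (i, s)]
  simp [sub_eq_add_neg]

/-- Orbits of tuples with nondegenerate span are cut out by the linear relations and the Gram
matrix. -/
theorem isZarClosed_vecOrbit {𝔽 : Type} [Field 𝔽] [IsAlgClosed 𝔽] [CharZero 𝔽] {n m : ℕ}
    {u : Fin m → (Fin n → 𝔽)} (hW : NondegOn (Submodule.span 𝔽 (Set.range u))) :
    IsZarClosed (vecOrbit u) := by
  refine ⟨{p | ∃ i j, p = ∑ s, X (i, s) * X (j, s) - C (u i ⬝ᵥ u j)} ∪
    {p | ∃ (c : Fin m → 𝔽) (s : Fin n), ∑ i, c i • u i = 0 ∧ p = ∑ i, C (c i) * X (i, s)}, ?_⟩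
  ext v
  constructor
  · rintro ⟨g, hg, h⟩ p (⟨i, j, rfl⟩ | ⟨c, s, hc, rfl⟩)
    · rw [← dotProduct_mulVec_of_mem_orthSet hg]
      simp [h, dotProduct]
    · have h0 : (g *ᵥ ∑ i, c i • u i) s = 0 := by rw [hc, mulVec_zero]; rfl
      rw [mulVec_sum, Finset.sum_apply] at h0
      simpa [h, mulVec_smul] using h0
  · intro hv
    let w : Fin m → (Fin n → 𝔽) := fun i s => v (i, s)
    have hgram : ∀ i j, w i ⬝ᵥ w j = u i ⬝ᵥ u j := fun i j => by
      simpa [dotProduct, w, sub_eq_zero] using hv _ (Or.inl ⟨i, j, rfl⟩)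
    have hrel : ∀ c : Fin m → 𝔽, ∑ i, c i • u i = 0 → ∑ i, c i • w i = 0 := fun c hc => by
      ext s
      simpa [w] using hv _ (Or.inr ⟨c, s, hc, rfl⟩)
    have hspan : LinearMap.range (Fintype.linearCombination 𝔽 u)
        = Submodule.span 𝔽 (Set.range u) := Fintype.range_linearCombination 𝔽 u
    rw [← hspan] at hW
    let T : LinearMap.range (Fintype.linearCombination 𝔽 u) →ₗ[𝔽] (Fin n → 𝔽) :=
      (LinearMap.ker (Fintype.linearCombination 𝔽 u)).liftQ (Fintype.linearCombination 𝔽 w)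
        (fun c hc => hrel c hc) ∘ₗ
        (Fintype.linearCombination 𝔽 u).quotKerEquivRange.symm.toLinearMap
    have hT : ∀ c, T ⟨Fintype.linearCombination 𝔽 u c, c, rfl⟩
        = Fintype.linearCombination 𝔽 w c := by
      intro c
      have : (Fintype.linearCombination 𝔽 u).quotKerEquivRange.symm
          ⟨Fintype.linearCombination 𝔽 u c, c, rfl⟩ = Submodule.Quotient.mk c := by
        rw [LinearEquiv.symm_apply_eq]; rfl
      simp only [T, LinearMap.comp_apply, LinearEquiv.coe_coe, this]
      rfl
    obtain ⟨g, hg, hgT⟩ := exists_mem_orthSet_extending hW T (by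
      rintro ⟨_, c, rfl⟩ ⟨_, c', rfl⟩
      rw [hT, hT]
      simp only [Fintype.linearCombination_apply, sum_dotProduct, dotProduct_sum,
        smul_dotProduct, dotProduct_smul, hgram])
    refine ⟨g, hg, fun p => ?_⟩
    have h1 : Fintype.linearCombination 𝔽 u (Pi.single p.1 1) = u p.1 := by
      simp [Fintype.linearCombination_apply_single]
    have h2 := hgT ⟨_, Pi.single p.1 1, rfl⟩
    rw [hT] at h2
    simp only [h1] at h2
    rw [h2]
    simp [Fintype.linearCombination_apply_single, w]

theorem exists_algHom_comp_eq_of_isIntegral {k A B : Type} [Field k] [IsAlgClosed k]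
    [CommRing A] [Algebra k A] [CommRing B] [Algebra k B] (f : A →ₐ[k] B)
    (hf : (f : A →+* B).IsIntegral) (ψ : A →ₐ[k] k) (h : ∀ x, f x = 0 → ψ x = 0) :
    ∃ χ : B →ₐ[k] k, ∀ x, χ (f x) = ψ x := by
  let _ : Algebra A B := (f : A →+* B).toAlgebra
  have : Algebra.IsIntegral A B := ⟨hf⟩
  have hψ : Function.Surjective (ψ : A →+* k) := fun c => ⟨algebraMap k A c, ψ.commutes c⟩
  have : (RingHom.ker (ψ : A →+* k)).IsMaximal := RingHom.ker_isMaximal_of_surjective _ hψ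
  obtain ⟨Q, hQ, hQψ⟩ := Ideal.exists_ideal_over_maximal_of_isIntegral (S := B)
    (RingHom.ker (ψ : A →+* k)) (fun x hx => h x hx)
  have hcomp : ∀ x, Ideal.Quotient.mk Q (f x) = algebraMap k (B ⧸ Q) (ψ x) := fun x => by
    have hx : x - algebraMap k A (ψ x) ∈ RingHom.ker (ψ : A →+* k) := by
      rw [RingHom.mem_ker]
      simp
    rw [← hQψ, Ideal.mem_comap] at hx
    have hx' : f (x - algebraMap k A (ψ x)) ∈ Q := hx
    rw [map_sub, f.commutes] at hx'
    rw [Ideal.Quotient.mk_eq_mk_iff_sub_mem _ _ |>.2 hx']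
    rfl
  have : Algebra.IsIntegral k (B ⧸ Q) := ⟨fun z => by
    obtain ⟨b, rfl⟩ := Ideal.Quotient.mk_surjective z
    obtain ⟨p, hp, hpb⟩ := hf b
    refine ⟨p.map (ψ : A →+* k), hp.map _, ?_⟩
    have hc : (algebraMap k (B ⧸ Q)).comp (ψ : A →+* k)
        = (Ideal.Quotient.mk Q).comp (f : A →+* B) := by
      ext x
      exact (hcomp x).symm
    rw [Polynomial.eval₂_map, hc, ← Polynomial.hom_eval₂, hpb, map_zero]⟩
  have hbij : Function.Bijective (Algebra.ofId k (B ⧸ Q)) :=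
    IsAlgClosed.algebraMap_bijective_of_isIntegral
  refine ⟨((AlgEquiv.ofBijective _ hbij).symm : (B ⧸ Q) →ₐ[k] k).comp (Ideal.Quotient.mkₐ k Q),
    fun x => ?_⟩
  have hx : Ideal.Quotient.mkₐ k Q (f x) = AlgEquiv.ofBijective _ hbij (ψ x) := hcomp x
  simp only [AlgHom.comp_apply, hx]
  exact AlgEquiv.symm_apply_apply _ _

theorem isZarClosed_image_of_isIntegral {k ι κ : Type} [Field k] [IsAlgClosed k]
    {S : Set (ι → k)} (hS : IsZarClosed S) (F : κ → MvPolynomial ι k)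
    (hint : ∀ i, ∃ q : Polynomial (MvPolynomial ι k), q.Monic ∧
      (∀ j, ∃ r : MvPolynomial κ k, ∀ v ∈ S,
        MvPolynomial.eval v (q.coeff j) = MvPolynomial.eval v (MvPolynomial.aeval F r)) ∧
      q.eval (MvPolynomial.X i) = 0) :
    IsZarClosed {y | ∃ v ∈ S, ∀ d, y d = MvPolynomial.eval v (F d)} := by
  obtain ⟨P, hP⟩ := hS
  have heval : ∀ v r, MvPolynomial.eval v (MvPolynomial.aeval F r)
      = MvPolynomial.eval (fun d => MvPolynomial.eval v (F d)) r := fun v r => by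
    induction r using MvPolynomial.induction_on with
    | C c => simp
    | add p q hp hq => rw [map_add, map_add, hp, hq, map_add]
    | mul_X p i hp => rw [map_mul, map_mul, hp, map_mul, MvPolynomial.aeval_X,
        MvPolynomial.eval_X]
  let I : Ideal (MvPolynomial ι k) :=
    { carrier := {p | ∀ v ∈ S, MvPolynomial.eval v p = 0}
      add_mem' := fun hp hq v hv => by rw [map_add, hp v hv, hq v hv, add_zero]
      zero_mem' := fun v _ => map_zero _
      smul_mem' := fun c p hp v hv => by rw [smul_eq_mul, map_mul, hp v hv, mul_zero] }
  have hI : ∀ p, Ideal.Quotient.mk I p = 0 ↔ ∀ v ∈ S, MvPolynomial.eval v p = 0 := fun p =>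
    Ideal.Quotient.eq_zero_iff_mem
  let f : MvPolynomial κ k →ₐ[k] (MvPolynomial ι k ⧸ I) :=
    (Ideal.Quotient.mkₐ k I).comp (MvPolynomial.aeval F)
  have hf0 : ∀ r, f r = 0 ↔
      ∀ v ∈ S, MvPolynomial.eval (fun d => MvPolynomial.eval v (F d)) r = 0 := fun r => by
    simp only [← heval]
    exact hI _
  have hf : (f : MvPolynomial κ k →+* (MvPolynomial ι k ⧸ I)).IsIntegral := fun z => by
    obtain ⟨p, rfl⟩ := Ideal.Quotient.mk_surjective z
    induction p using MvPolynomial.induction_on with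
    | C c =>
      have : (f : MvPolynomial κ k →+* (MvPolynomial ι k ⧸ I)) (MvPolynomial.C c)
          = Ideal.Quotient.mk I (MvPolynomial.C c) := f.commutes c
      rw [← this]
      exact RingHom.isIntegralElem_map _
    | add p q hp hq => rw [map_add]; exact RingHom.IsIntegralElem.add _ hp hq
    | mul_X p i hp =>
      rw [map_mul]
      refine RingHom.IsIntegralElem.mul _ hp ?_
      obtain ⟨q, hq, hqr, hqi⟩ := hint i
      have hl : q.map (Ideal.Quotient.mk I) ∈
          Polynomial.lifts (f : MvPolynomial κ k →+* (MvPolynomial ι k ⧸ I)) := by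
        rw [Polynomial.lifts_iff_coeff_lifts]
        intro j
        obtain ⟨r, hr⟩ := hqr j
        refine ⟨r, ?_⟩
        rw [Polynomial.coeff_map]
        refine (Ideal.Quotient.mk_eq_mk_iff_sub_mem _ _).2 fun v hv => ?_
        rw [map_sub, hr v hv]
        exact sub_self _
      obtain ⟨q', hq', -, hm⟩ := Polynomial.lifts_and_natDegree_eq_and_monic hl (hq.map _)
      refine ⟨q', hm, ?_⟩
      rw [Polynomial.eval₂_eq_eval_map, hq', Polynomial.eval_map, Polynomial.eval₂_hom, hqi,
        map_zero]
  refine ⟨{r | ∀ v ∈ S, MvPolynomial.eval (fun d => MvPolynomial.eval v (F d)) r = 0}, ?_⟩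
  ext y
  constructor
  · rintro ⟨v, hv, hy⟩ r hr
    rw [funext hy]
    exact hr v hv
  · intro hy
    obtain ⟨χ, hχ⟩ := exists_algHom_comp_eq_of_isIntegral f hf (MvPolynomial.aeval y)
      fun r hr => hy r ((hf0 r).1 hr)
    have hχe : ∀ p, χ (Ideal.Quotient.mk I p)
        = MvPolynomial.eval (fun i => χ (Ideal.Quotient.mk I (MvPolynomial.X i))) p := fun p => by
      have : χ.comp (Ideal.Quotient.mkₐ k I)
          = MvPolynomial.aeval (fun i => χ (Ideal.Quotient.mk I (MvPolynomial.X i))) := by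
        ext i
        simp
      exact DFunLike.congr_fun this p
    refine ⟨fun i => χ (Ideal.Quotient.mk I (MvPolynomial.X i)), ?_, fun d => ?_⟩
    · rw [hP]
      intro p hp
      rw [← hχe, (hI p).2 fun v hv => ?_, map_zero]
      rw [hP] at hv
      exact hv p hp
    · rw [← hχe]
      have := hχ (MvPolynomial.X d)
      rw [MvPolynomial.aeval_X] at this
      rw [← this]
      simp [f]

/-- The polynomial functions on `m`-tuples of vectors giving the coordinates of the spin model. -/
noncomputable def weightedPowerSum {k : Type} [Field k] {m n : ℕ} (a : Fin m → k)
    (d : Fin n →₀ ℕ) : MvPolynomial (Fin m × Fin n) k :=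
  ∑ i, MvPolynomial.C (a i) * ∏ s, MvPolynomial.X (i, s) ^ d s

theorem eval_weightedPowerSum {k : Type} [Field k] {m n : ℕ} (a : Fin m → k)
    (d : Fin n →₀ ℕ) (v : Fin m × Fin n → k) :
    MvPolynomial.eval v (weightedPowerSum a d) = ∑ i, a i * ∏ s, v (i, s) ^ d s := by
  simp [weightedPowerSum]

theorem restOrbit_spinModel_eq {k : Type} [Field k] {m n : ℕ} (u : Fin m → (Fin n → k))
    (a : Fin m → k) (e : ℕ) :
    restOrbit (spinModel u a) e = {y | ∃ v ∈ vecOrbit u, ∀ d : LowDeg n e,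
      y d = MvPolynomial.eval v (weightedPowerSum a d.1)} := by
  have key : ∀ (g : Matrix (Fin n) (Fin n) k) (v : Fin m × Fin n → k)
      (_ : ∀ p : Fin m × Fin n, v p = g.mulVec (u p.1) p.2) (d : Fin n →₀ ℕ),
      dualAct g (spinModel u a) (MvPolynomial.monomial d (1 : k))
        = MvPolynomial.eval v (weightedPowerSum a d) := fun g v hv d => by
    rw [dualAct_spinModel, spinModel_apply, eval_weightedPowerSum]
    refine Finset.sum_congr rfl fun i _ => ?_
    rw [MvPolynomial.eval_monomial, one_mul, Finsupp.prod_fintype _ _ (fun _ => pow_zero _)]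
    simp only [hv]
  ext y
  constructor
  · rintro ⟨g, hg, hy⟩
    exact ⟨fun p => g.mulVec (u p.1) p.2, ⟨g, hg, fun _ => rfl⟩,
      fun d => (hy d).trans (key g _ (fun _ => rfl) d.1)⟩
  · rintro ⟨v, ⟨g, hg, hv⟩, hy⟩
    exact ⟨g, hg, fun d => (hy d).trans (key g v hv d.1).symm⟩

theorem exists_eval_aeval_weightedPowerSum_eq_sum {k : Type} [Field k] {m n e : ℕ}
    (a : Fin m → k) (p : MvPolynomial (Fin m × Fin n) k) (hp : p.totalDegree ≤ e) :
    ∃ r : MvPolynomial (LowDeg n e) k, ∀ v,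
      MvPolynomial.eval v (MvPolynomial.aeval (fun d : LowDeg n e => weightedPowerSum a d.1) r)
        = ∑ l : Fin m → Fin m, (∏ i, a (l i)) *
            MvPolynomial.eval (fun q => v (l q.1, q.2)) p := by
  let α : (Fin m × Fin n →₀ ℕ) → Fin m → (Fin n →₀ ℕ) := fun c i =>
    Finsupp.equivFunOnFinite.symm fun s => c (i, s)
  have hα : ∀ c ∈ p.support, ∀ i, ((α c i).sum fun _ c => c) ≤ e := fun c hc i => by
    refine le_trans ?_ ((MvPolynomial.le_totalDegree hc).trans hp)
    rw [Finsupp.sum_fintype _ _ (fun _ => rfl), Finsupp.sum_fintype _ _ (fun _ => rfl),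
      Fintype.sum_prod_type]
    exact Finset.single_le_sum (f := fun i => ∑ s, c (i, s)) (fun _ _ => Nat.zero_le _)
      (Finset.mem_univ i)
  choose δ hδ using fun (c : p.support) i => show ∃ d : LowDeg n e, d.1 = α c.1 i from
    ⟨⟨α c.1 i, hα c.1 c.2 i⟩, rfl⟩
  refine ⟨∑ c ∈ p.support.attach, MvPolynomial.C (p.coeff c.1) *
    ∏ i, MvPolynomial.X (δ c i), fun v => ?_⟩
  simp only [MvPolynomial.eval_eq' _ p, map_sum, map_mul, map_prod, MvPolynomial.aeval_X,
    MvPolynomial.aeval_C, eval_weightedPowerSum, MvPolynomial.algebraMap_eq,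
    MvPolynomial.eval_C, hδ]
  rw [Finset.sum_attach p.support (fun c => p.coeff c *
    ∏ i, ∑ j, a j * ∏ s, v (j, s) ^ (α c i s))]
  simp only [Finset.mul_sum]
  rw [Finset.sum_comm]
  refine Finset.sum_congr rfl fun c _ => ?_
  rw [Finset.prod_univ_sum, Fintype.piFinset_univ, Finset.mul_sum]
  refine Finset.sum_congr rfl fun l _ => ?_
  rw [Finset.prod_mul_distrib, Fintype.prod_prod_type]
  simp only [α, Finsupp.equivFunOnFinite_symm_apply_apply]
  ring

theorem injective_gram_of_nondegOn {k : Type} [Field k] {m n : ℕ} {u : Fin m → (Fin n → k)}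
    (hu : Function.Injective u) (hW : NondegOn (Submodule.span k (Set.range u))) {i j : Fin m}
    (h : ∀ t, u i ⬝ᵥ u t = u j ⬝ᵥ u t) : i = j := by
  refine hu (sub_eq_zero.1 (hW _ (Submodule.sub_mem _
    (Submodule.subset_span ⟨i, rfl⟩) (Submodule.subset_span ⟨j, rfl⟩)) fun y hy => ?_))
  induction hy using Submodule.span_induction with
  | mem y hy =>
    obtain ⟨t, rfl⟩ := hy
    rw [sub_dotProduct, h t, sub_self]
  | zero => exact dotProduct_zero _
  | add x y _ _ hx hy => rw [dotProduct_add, hx, hy, add_zero]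
  | smul c x _ hx => rw [dotProduct_smul, hx, smul_zero]

theorem exists_gram_separating {k : Type} [Field k] {m n : ℕ} (u : Fin m → (Fin n → k)) :
    ∃ Q : MvPolynomial (Fin m × Fin n) k, ∀ v ∈ vecOrbit u, ∀ l : Fin m → Fin m,
      ((∀ i j, u (l i) ⬝ᵥ u (l j) = u i ⬝ᵥ u j) →
        MvPolynomial.eval (fun q => v (l q.1, q.2)) Q = 1) ∧
      ((¬ ∀ i j, u (l i) ⬝ᵥ u (l j) = u i ⬝ᵥ u j) →
        MvPolynomial.eval (fun q => v (l q.1, q.2)) Q = 0) := by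
  classical
  let G : (Fin m → Fin m) → Fin m × Fin m → k := fun l p => u (l p.1) ⬝ᵥ u (l p.2)
  obtain ⟨q, -, hq, hq0⟩ := exists_totalDegree_le_card_eval_ne_zero (z := G id)
    ((Finset.univ.filter fun l => G l ≠ G id).image G) (by simp)
  have hG : ∀ l, G l = G id ↔ ∀ i j, u (l i) ⬝ᵥ u (l j) = u i ⬝ᵥ u j := fun l =>
    ⟨fun h i j => congrFun h (i, j), fun h => funext fun p => h p.1 p.2⟩
  refine ⟨MvPolynomial.C (MvPolynomial.eval (G id) q)⁻¹ * MvPolynomial.aeval (fun p =>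
    ∑ s, MvPolynomial.X (p.1, s) * MvPolynomial.X (p.2, s)) q, ?_⟩
  rintro v ⟨g, hg, hv⟩ l
  have hval : MvPolynomial.eval (fun q => v (l q.1, q.2))
      (MvPolynomial.C (MvPolynomial.eval (G id) q)⁻¹ * MvPolynomial.aeval (fun p =>
        ∑ s, MvPolynomial.X (p.1, s) * MvPolynomial.X (p.2, s)) q)
      = (MvPolynomial.eval (G id) q)⁻¹ * MvPolynomial.eval (G l) q := by
    rw [map_mul, MvPolynomial.eval_C]
    congr 1
    have : (MvPolynomial.aeval (fun q : Fin m × Fin n => v (l q.1, q.2))).comp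
        (MvPolynomial.aeval (R := k) (fun p : Fin m × Fin m => (∑ s : Fin n,
          MvPolynomial.X (p.1, s) * MvPolynomial.X (p.2, s) :
            MvPolynomial (Fin m × Fin n) k))) = MvPolynomial.aeval (G l) := by
      ext p
      simp only [AlgHom.comp_apply, MvPolynomial.aeval_X, map_sum, map_mul, hv, G]
      exact dotProduct_mulVec_of_mem_orthSet hg _ _
    exact DFunLike.congr_fun this q
  rw [hval, ← hG]
  refine ⟨fun h => by rw [h, inv_mul_cancel₀ hq], fun h => ?_⟩
  rw [hq0 (G l) (Finset.mem_image_of_mem _ (by simpa using h)), mul_zero]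

theorem exists_eval_aeval_weightedPowerSum_eq_of_symmetric {k : Type} [Field k] [CharZero k]
    {m n : ℕ} {u : Fin m → (Fin n → k)} (hu : Function.Injective u) {a : Fin m → k}
    (ha : ∀ i, a i ≠ 0) (hW : NondegOn (Submodule.span k (Set.range u)))
    (p : MvPolynomial (Fin m × Fin n) k)
    (hp : ∀ (σ : Equiv.Perm (Fin m)) v, MvPolynomial.eval (fun q => v (σ q.1, q.2)) p
      = MvPolynomial.eval v p) :
    ∃ E : ℕ, ∀ e, E ≤ e → ∃ r : MvPolynomial (LowDeg n e) k, ∀ v ∈ vecOrbit u,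
      MvPolynomial.eval v p = MvPolynomial.eval v
        (MvPolynomial.aeval (fun d : LowDeg n e => weightedPowerSum a d.1) r) := by
  classical
  obtain ⟨Q, hQ⟩ := exists_gram_separating u
  let N := Finset.univ.filter fun l : Fin m → Fin m => ∀ i j, u (l i) ⬝ᵥ u (l j) = u i ⬝ᵥ u j
  have hN : (N.card : k) ≠ 0 := Nat.cast_ne_zero.2
    (Finset.card_ne_zero.2 ⟨id, by simp [N]⟩)
  have hc : (N.card : k) * ∏ i, a i ≠ 0 :=
    mul_ne_zero hN (Finset.prod_ne_zero_iff.2 fun i _ => ha i)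
  refine ⟨(Q * p).totalDegree, fun e he => ?_⟩
  obtain ⟨r, hr⟩ := exists_eval_aeval_weightedPowerSum_eq_sum a (Q * p) he
  refine ⟨MvPolynomial.C ((N.card : k) * ∏ i, a i)⁻¹ * r, fun v hv => ?_⟩
  rw [map_mul, map_mul, hr v, MvPolynomial.aeval_C, MvPolynomial.algebraMap_eq,
    MvPolynomial.eval_C, eq_inv_mul_iff_mul_eq₀ hc]
  symm
  rw [← Finset.sum_subset (Finset.subset_univ N), Finset.sum_congr rfl fun l hl => ?_,
    Finset.sum_const, nsmul_eq_mul, mul_assoc]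
  · have hl' := (Finset.mem_filter.1 hl).2
    have hinj : Function.Injective l := fun i j hij => injective_gram_of_nondegOn hu hW fun t => by
      rw [← hl' i t, ← hl' j t, hij]
    let σ : Equiv.Perm (Fin m) := Equiv.ofBijective l (Finite.injective_iff_bijective.1 hinj)
    rw [map_mul, (hQ v hv l).1 hl', one_mul]
    exact congrArg₂ _ (Equiv.prod_comp σ a) (hp σ v)
  · intro l _ hl
    rw [map_mul, (hQ v hv l).2 fun h => hl (Finset.mem_filter.2 ⟨Finset.mem_univ _, h⟩), zero_mul,
      mul_zero]

theorem exists_forall_isZarClosed_restOrbit {k : Type} [Field k] [IsAlgClosed k] [CharZero k]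
    {m n : ℕ} {u : Fin m → (Fin n → k)} (hu : Function.Injective u) {a : Fin m → k}
    (ha : ∀ i, a i ≠ 0) (hW : NondegOn (Submodule.span k (Set.range u))) :
    ∃ E : ℕ, ∀ e, E ≤ e → IsZarClosed (restOrbit (spinModel u a) e) := by
  let P : Fin n → Polynomial (MvPolynomial (Fin m × Fin n) k) := fun s =>
    ∏ i, (Polynomial.X - Polynomial.C (MvPolynomial.X (i, s)))
  have hsymm : ∀ s j (σ : Equiv.Perm (Fin m)) (v : Fin m × Fin n → k),
      MvPolynomial.eval (fun q => v (σ q.1, q.2)) ((P s).coeff j)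
        = MvPolynomial.eval v ((P s).coeff j) := fun s j σ v => by
    rw [← Polynomial.coeff_map, ← Polynomial.coeff_map]
    congr 1
    simp only [P, Polynomial.map_prod, Polynomial.map_sub, Polynomial.map_X, Polynomial.map_C,
      MvPolynomial.eval_X]
    exact Equiv.prod_comp σ fun i => Polynomial.X - Polynomial.C (v (i, s))
  have hP : ∀ s, (P s).Monic := fun s =>
    Polynomial.monic_prod_of_monic _ _ fun i _ => Polynomial.monic_X_sub_C _
  choose E hE using fun s j => exists_eval_aeval_weightedPowerSum_eq_of_symmetric hu ha hW
    ((P s).coeff j) (hsymm s j)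
  refine ⟨Finset.univ.sup fun s => (Finset.range ((P s).natDegree + 1)).sup (E s), fun e he => ?_⟩
  rw [restOrbit_spinModel_eq]
  refine isZarClosed_image_of_isIntegral (isZarClosed_vecOrbit hW) _ fun q =>
    ⟨P q.2, hP q.2, fun j => ?_, ?_⟩
  · rcases lt_or_ge (P q.2).natDegree j with hj | hj
    · exact ⟨0, fun v _ => by rw [Polynomial.coeff_eq_zero_of_natDegree_lt hj, map_zero, map_zero,
        map_zero]⟩
    · refine hE q.2 j e (le_trans ?_ he)
      exact (Finset.le_sup (f := E q.2) (Finset.mem_range.2 (Nat.lt_succ_of_le hj))).trans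
        (Finset.le_sup (f := fun s => (Finset.range ((P s).natDegree + 1)).sup (E s))
          (Finset.mem_univ q.2))
  · rw [Polynomial.eval_prod]
    exact Finset.prod_eq_zero (Finset.mem_univ q.1) (by simp)

end VertexModels

open VertexModels

/-- **Theorem 14** (spin models).  For `h(p) = ∑ᵢ aᵢ p(uᵢ)` with the `uᵢ`
distinct and the `aᵢ` nonzero: the orbit `O_n h_e` is closed for all
sufficiently large `e` iff the orbit of `(u_1, …, u_m)` in `V^m` is closed,
iff the bilinear form restricted to the span of the `uᵢ` is nondegenerate. -/
theorem spin_model_orbit_closed_tfae (𝔽 : Type) [Field 𝔽] [IsAlgClosed 𝔽]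
    [CharZero 𝔽] (n m : ℕ) (u : Fin m → (Fin n → 𝔽)) (hu : Function.Injective u)
    (a : Fin m → 𝔽) (ha : ∀ i, a i ≠ 0) :
    ((∃ E : ℕ, ∀ e : ℕ, E ≤ e → IsZarClosed (restOrbit (spinModel u a) e)) ↔
        IsZarClosed (vecOrbit u)) ∧
    (IsZarClosed (vecOrbit u) ↔
      ∀ x ∈ Submodule.span 𝔽 (Set.range u),
        (∀ y ∈ Submodule.span 𝔽 (Set.range u), (∑ i, x i * y i) = 0) → x = 0) := by
  have h31 := exists_forall_isZarClosed_restOrbit (k := 𝔽) hu ha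
  have h32 := isZarClosed_vecOrbit (u := u)
  have h23 := nondegOn_of_isZarClosed_vecOrbit (u := u)
  have h13 : (∃ E : ℕ, ∀ e : ℕ, E ≤ e → IsZarClosed (restOrbit (spinModel u a) e)) →
      NondegOn (Submodule.span 𝔽 (Set.range u)) := fun ⟨E, hE⟩ =>
    nondegOn_of_isZarClosed_restOrbit hu ha (le_max_right E (m + m)) (hE _ (le_max_left _ _))
  exact ⟨⟨fun h => h32 (h13 h), fun h => h31 (h23 h)⟩, h23, h32⟩
end
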